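/- arXiv:2405.17932 — 5 statements merged into one kernel-verified Lean document; each statement's English description precedes it below -/
import Mathlib

section
/- Let d and k be positive integers with 1 ≤ k ≤ d. For every vector x ∈ ℝ^d, the Top-k sparsifier satisfies the k-contraction property ‖x − Top_k(x)‖² ≤ (1 − k/d)·‖x‖², where ‖·‖ is the Euclidean norm. -/
/-- **k-contraction property of the Top-k sparsifier.**
For `1 ≤ k ≤ d`, any `x ∈ ℝ^d`, any permutation `π` sorting the coordinates of `x`
by nonincreasing absolute value, and `y` the Top-k sparsification of `x` along `π`
(keeping the `k` largest-magnitude coordinates and zeroing the rest),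
we have `‖x − y‖² ≤ (1 − k/d) ‖x‖²`. -/
theorem topk_contraction (d k : ℕ) (hk1 : 1 ≤ k) (hkd : k ≤ d)
    (x y : EuclideanSpace ℝ (Fin d)) (π : Equiv.Perm (Fin d))
    (hsort : ∀ j : Fin d, ∀ h : (j : ℕ) + 1 < d, |x (π ⟨(j : ℕ) + 1, h⟩)| ≤ |x (π j)|)
    (hy : ∀ j : Fin d, y (π j) = if (j : ℕ) < k then x (π j) else 0) :
    ‖x - y‖ ^ 2 ≤ (1 - (k : ℝ) / d) * ‖x‖ ^ 2 := by
  have hdpos : 0 < d := by omega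
  have hd : (0 : ℝ) < d := by exact_mod_cast hdpos
  have hkd' : (k : ℝ) ≤ d := by exact_mod_cast hkd
  have hanti : ∀ n : ℕ, ∀ i : Fin d, ∀ h : (i : ℕ) + n < d,
      |x (π ⟨(i : ℕ) + n, h⟩)| ≤ |x (π i)| := by
    intro n i
    induction n with
    | zero => intro h; exact le_refl _
    | succ n ih =>
      intro h
      have h' : (i : ℕ) + n < d := by omega
      exact (hsort ⟨(i : ℕ) + n, h'⟩ h).trans (ih h')
  have hle : ∀ i j : Fin d, i ≤ j → x (π j) ^ 2 ≤ x (π i) ^ 2 := by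
    intro i j hij
    have hij' : (i : ℕ) ≤ j := hij
    have h1 : (i : ℕ) + ((j : ℕ) - i) < d := by have := j.2; omega
    have h2 : (⟨(i : ℕ) + ((j : ℕ) - i), h1⟩ : Fin d) = j := by
      apply Fin.ext; simp only; omega
    have h3 := hanti _ i h1
    rw [h2] at h3
    exact sq_le_sq.mpr h3
  let m : Fin d := ⟨k - 1, by omega⟩
  set t := x (π m) ^ 2 with ht
  have hx : ‖x‖ ^ 2 = ∑ j, x (π j) ^ 2 := by
    rw [EuclideanSpace.real_norm_sq_eq]
    exact (Equiv.sum_comp π (fun i => x i ^ 2)).symm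
  have hxy : ‖x - y‖ ^ 2 = ∑ j : Fin d, if (j : ℕ) < k then 0 else x (π j) ^ 2 := by
    rw [EuclideanSpace.real_norm_sq_eq, ← Equiv.sum_comp π]
    refine Finset.sum_congr rfl fun j _ => ?_
    rw [PiLp.sub_apply, hy]
    split_ifs <;> simp
  have hr0 : 0 ≤ (k : ℝ) / d := by positivity
  have hr1 : (k : ℝ) / d ≤ 1 := (div_le_one hd).mpr hkd'
  have key : ∀ j : Fin d, (if (j : ℕ) < k then 0 else x (π j) ^ 2)
      - (1 - (k : ℝ) / d) * x (π j) ^ 2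
      ≤ t * ((k : ℝ) / d - if (j : ℕ) < k then 1 else 0) := by
    intro j
    split_ifs with h
    · have : t ≤ x (π j) ^ 2 := hle j m (by show (j : ℕ) ≤ k - 1; omega)
      nlinarith
    · have : x (π j) ^ 2 ≤ t := hle m j (by show k - 1 ≤ (j : ℕ); omega)
      nlinarith
  have hcard : ∑ j : Fin d, (if (j : ℕ) < k then (1 : ℝ) else 0) = k := by
    rw [Fin.sum_univ_eq_sum_range (fun j => if j < k then (1 : ℝ) else 0) d,
      ← Finset.sum_filter]
    have : (Finset.range d).filter (· < k) = Finset.range k := by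
      ext a; simp only [Finset.mem_filter, Finset.mem_range]; omega
    rw [this]; simp
  have hsum := Finset.sum_le_sum fun j (_ : j ∈ Finset.univ) => key j
  rw [Finset.sum_sub_distrib, ← Finset.mul_sum, ← Finset.mul_sum, Finset.sum_sub_distrib,
    hcard, ← hxy, ← hx] at hsum
  have : ∑ _j : Fin d, (k : ℝ) / d = k := by
    simp; field_simp
  rw [this] at hsum
  linarith
end

section
/- In the FedAdam-SSM setup, for every round t ≥ 0 and every coordinate j ∈ {1,…,d}, the global moment estimates satisfy |[Mᵗ]_j| ≤ G(1 − β₁^{Lt}) and 0 ≤ [Vᵗ]_j ≤ G²(1 − β₂^{Lt}). -/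
lemma round_upper {N L k : ℕ} (β C x : ℝ) (h0 : 0 ≤ β) (h1 : β < 1) (hC : 0 ≤ C)
    (lam s : Fin N → ℝ) (hl : ∀ n, 0 ≤ lam n) (hsum : ∑ n, lam n = 1)
    (hs : ∀ n, s n = 0 ∨ s n = 1) (u g : Fin N → ℕ → ℝ) (hu0 : ∀ n, u n 0 = x)
    (hg : ∀ n l, g n l ≤ C)
    (hu : ∀ n l, l < L → u n (l + 1) = β * u n l + (1 - β) * g n l)
    (hx : x ≤ C * (1 - β ^ k)) :
    x + ∑ n, lam n * (s n * (u n L - x)) ≤ C * (1 - β ^ (k + L)) := by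
  have key : ∀ n l, l ≤ L → u n l ≤ C * (1 - β ^ (k + l)) := by
    intro n l
    induction l with
    | zero => intro _; simpa [hu0 n] using hx
    | succ l ih =>
      intro hl
      have a := mul_le_mul_of_nonneg_left (ih (by omega)) h0
      have b := mul_le_mul_of_nonneg_left (hg n l) (sub_nonneg.2 h1.le)
      rw [hu n l (by omega), ← add_assoc, pow_succ]
      linarith
  have hx' : x ≤ C * (1 - β ^ (k + L)) := by
    refine hx.trans (mul_le_mul_of_nonneg_left ?_ hC)
    have := pow_le_pow_of_le_one h0 h1.le (Nat.le_add_right k L)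
    linarith
  have hb : ∑ n, lam n * (s n * (u n L - x)) ≤ ∑ n, lam n * (C * (1 - β ^ (k + L)) - x) := by
    refine Finset.sum_le_sum fun n _ => mul_le_mul_of_nonneg_left ?_ (hl n)
    have := key n L le_rfl
    rcases hs n with h | h <;> rw [h] <;> linarith
  rw [← Finset.sum_mul, hsum] at hb
  linarith


/-- **Lemma 1 (bounds on the global moment estimates of FedAdam-SSM).**
In the FedAdam-SSM iteration (local Adam updates over `L` epochs, arbitrary binary
sparse masks, weighted server aggregation), if every mini-batch gradient has
coordinates bounded in absolute value by `G`, then for every round `t` and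
coordinate `j`, `|[Mᵗ]_j| ≤ G(1 − β₁^{Lt})` and `0 ≤ [Vᵗ]_j ≤ G²(1 − β₂^{Lt})`. -/
theorem fedadam_ssm_global_moment_bounds
    (d N L : ℕ) (hd : 1 ≤ d) (hN : 1 ≤ N) (hL : 1 ≤ L)
    (β₁ β₂ η ε G : ℝ)
    (hβ₁0 : 0 ≤ β₁) (hβ₁1 : β₁ < 1) (hβ₂0 : 0 ≤ β₂) (hβ₂1 : β₂ < 1)
    (hη : 0 < η) (hε : 0 < ε) (hG : 0 < G)
    (Dt : Fin N → ℝ) (hDt : ∀ n, 0 < Dt n)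
    (lam : Fin N → ℝ) (hlam : ∀ n, lam n = Dt n / ∑ p, Dt p)
    -- mini-batch gradient maps ∇F̃_{n,l,t}, coordinatewise bounded by G
    (gradFt : Fin N → ℕ → ℕ → EuclideanSpace ℝ (Fin d) → EuclideanSpace ℝ (Fin d))
    (hbd : ∀ n l t x j, |gradFt n l t x j| ≤ G)
    -- global and local iterates
    (M V W : ℕ → EuclideanSpace ℝ (Fin d))
    (m v w : Fin N → ℕ → ℕ → EuclideanSpace ℝ (Fin d))
    (hM0 : M 0 = 0) (hV0 : V 0 = 0)
    (hm0 : ∀ n t, m n 0 t = M t) (hv0 : ∀ n t, v n 0 t = V t)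
    (hw0 : ∀ n t, w n 0 t = W t)
    (hmrec : ∀ n l t, l < L → ∀ j,
      m n (l + 1) t j = β₁ * m n l t j + (1 - β₁) * gradFt n (l + 1) t (w n l t) j)
    (hvrec : ∀ n l t, l < L → ∀ j,
      v n (l + 1) t j = β₂ * v n l t j + (1 - β₂) * (gradFt n (l + 1) t (w n l t) j) ^ 2)
    (hwrec : ∀ n l t, l < L → ∀ j,
      w n (l + 1) t j = w n l t j - η * m n (l + 1) t j / Real.sqrt (v n (l + 1) t j + ε))
    -- arbitrary binary masks and sparse aggregation
    (s : Fin N → ℕ → Fin d → ℝ) (hs : ∀ n t j, s n t j = 0 ∨ s n t j = 1)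
    (hMagg : ∀ t j, M (t + 1) j = M t j + ∑ n, lam n * (s n t j * (m n L t j - M t j)))
    (hVagg : ∀ t j, V (t + 1) j = V t j + ∑ n, lam n * (s n t j * (v n L t j - V t j)))
    (hWagg : ∀ t j, W (t + 1) j = W t j + ∑ n, lam n * (s n t j * (w n L t j - W t j))) :
    ∀ t j, |M t j| ≤ G * (1 - β₁ ^ (L * t)) ∧
      0 ≤ V t j ∧ V t j ≤ G ^ 2 * (1 - β₂ ^ (L * t)) := by
  have : Nonempty (Fin N) := ⟨⟨0, hN⟩⟩
  have hpos : 0 < ∑ p, Dt p := Finset.sum_pos (fun n _ => hDt n) Finset.univ_nonempty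
  have hl : ∀ n, 0 ≤ lam n := fun n => by
    rw [hlam n]; exact div_nonneg (hDt n).le hpos.le
  have hsum : ∑ n, lam n = 1 := by
    simp_rw [hlam]
    rw [← Finset.sum_div, div_self hpos.ne']
  intro t j
  induction t with
  | zero => simp [hM0, hV0]
  | succ t ih =>
    obtain ⟨ihM, ihV0, ihV⟩ := ih
    obtain ⟨ihM1, ihM2⟩ := abs_le.1 ihM
    have neg : ∀ (x : ℝ) (u : Fin N → ℝ), -x + ∑ n, lam n * (s n t j * (-u n - -x))
        = -(x + ∑ n, lam n * (s n t j * (u n - x))) := by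
      intro x u
      rw [neg_add, ← Finset.sum_neg_distrib]
      congr 1
      exact Finset.sum_congr rfl fun n _ => by ring
    have A := round_upper (L := L) β₁ G (M t j) hβ₁0 hβ₁1 hG.le lam (fun n => s n t j) hl hsum
      (fun n => hs n t j) (fun n l => m n l t j) (fun n l => gradFt n (l + 1) t (w n l t) j)
      (fun n => by simp only [hm0]) (fun n l => (abs_le.1 (hbd _ _ _ _ _)).2)
      (fun n l h => hmrec n l t h j) ihM2
    have B := round_upper (L := L) β₁ G (-M t j) hβ₁0 hβ₁1 hG.le lam (fun n => s n t j) hl hsum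
      (fun n => hs n t j) (fun n l => -m n l t j) (fun n l => -gradFt n (l + 1) t (w n l t) j)
      (fun n => by simp only [hm0])
      (fun n l => by have := (abs_le.1 (hbd n (l + 1) t (w n l t) j)).1; linarith)
      (fun n l h => by rw [hmrec n l t h j]; ring) (k := L * t) (by linarith)
    have D := round_upper (L := L) β₂ (G ^ 2) (V t j) hβ₂0 hβ₂1 (sq_nonneg G) lam
      (fun n => s n t j) hl hsum
      (fun n => hs n t j) (fun n l => v n l t j)
      (fun n l => (gradFt n (l + 1) t (w n l t) j) ^ 2)
      (fun n => by simp only [hv0])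
      (fun n l => sq_le_sq' (abs_le.1 (hbd _ _ _ _ _)).1 (abs_le.1 (hbd _ _ _ _ _)).2)
      (fun n l h => hvrec n l t h j) ihV
    have E := round_upper (L := L) β₂ 0 (-V t j) hβ₂0 hβ₂1 le_rfl lam
      (fun n => s n t j) hl hsum
      (fun n => hs n t j) (fun n l => -v n l t j)
      (fun n l => -(gradFt n (l + 1) t (w n l t) j) ^ 2)
      (fun n => by simp only [hv0])
      (fun n l => neg_nonpos.2 (sq_nonneg _))
      (fun n l h => by rw [hvrec n l t h j]; ring) (k := L * t) (by linarith)
    simp only [neg] at B E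
    rw [← hMagg, ← Nat.mul_succ] at A B
    rw [← hVagg] at D E
    rw [← Nat.mul_succ] at D
    refine ⟨abs_le.2 ⟨neg_le.1 B, A⟩, by linarith, D⟩
end

section
/- Let d ≥ 1, β₁ ∈ [0,1), β₂ ∈ [0,1), η > 0, ε > 0, ρ ≥ 0, G > 0, σ_l ≥ 0, σ_g ≥ 0, D̃ > 0. Let g̃, g_n, g : ℝ^d → ℝ^d be maps such that g_n is ρ-Lipschitz, every coordinate of g̃(w), g_n(w) and g(w) has absolute value at most G, ‖g̃(w) − g_n(w)‖ ≤ σ_l/√D̃ and ‖g_n(w) − g(w)‖ ≤ σ_g for all w. Let M, V, W, M̆, V̆, W̆ ∈ ℝ^d with |M_j| ≤ G, |M̆_j| ≤ G, 0 ≤ V_j, and 0 ≤ V̆_j for all coordinates j. Define the one-step Adam iterates w¹ = W − η(β₁ M + (1−β₁) g̃(W)) ⊘ √(β₂ V + (1−β₂) g̃(W)² + ε) and w̌¹ = W̆ − η(β₁ M̆ + (1−β₁) g(W̆)) ⊘ √(β₂ V̆ + (1−β₂) g(W̆)² + ε), with squares, divisions and square roots taken coordinatewise. Then ‖w¹ −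 w̌¹‖ ≤ (1 + (ηρ/√ε)(1−β₁) + (dG²ηρ/(ε√ε))(1−β₂)) ‖W − W̆‖ + (ηβ₁/√ε) ‖M − M̆‖ + (√d G η β₂/(2ε√ε)) ‖V − V̆‖ + ((η/√ε)(1−β₁) + (dG²η/(ε√ε))(1−β₂)) (σ_l/√D̃ + σ_g). -/
lemma aux_norm_mono {d : ℕ} (u v : EuclideanSpace ℝ (Fin d)) (h : ∀ j, |u j| ≤ |v j|) :
    ‖u‖ ≤ ‖v‖ := by
  rw [EuclideanSpace.norm_eq, EuclideanSpace.norm_eq]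
  apply Real.sqrt_le_sqrt
  apply Finset.sum_le_sum
  intro j _
  simp only [Real.norm_eq_abs]
  exact pow_le_pow_left₀ (abs_nonneg _) (h j) 2

lemma aux_abs_vec {d : ℕ} (x : EuclideanSpace ℝ (Fin d)) :
    ∃ y : EuclideanSpace ℝ (Fin d), (∀ j, y j = |x j|) ∧ ‖y‖ ≤ ‖x‖ := by
  refine ⟨WithLp.toLp 2 (fun j => |x j|), fun j => rfl, aux_norm_mono _ _ fun j => ?_⟩
  simp

lemma aux_comb {d : ℕ} (u x y z t : EuclideanSpace ℝ (Fin d)) (a b c : ℝ)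
    (ha : 0 ≤ a) (hb : 0 ≤ b) (hc : 0 ≤ c)
    (h : ∀ j, |u j| ≤ |x j| + a * |y j| + b * |z j| + c * |t j|) :
    ‖u‖ ≤ ‖x‖ + a * ‖y‖ + b * ‖z‖ + c * ‖t‖ := by
  obtain ⟨x', hx, hx'⟩ := aux_abs_vec x
  obtain ⟨y', hy, hy'⟩ := aux_abs_vec y
  obtain ⟨z', hz, hz'⟩ := aux_abs_vec z
  obtain ⟨t', ht, ht'⟩ := aux_abs_vec t
  have h1 : ‖u‖ ≤ ‖x' + a • y' + b • z' + c • t'‖ := by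
    apply aux_norm_mono
    intro j
    refine le_trans (h j) (le_trans (le_of_eq ?_) (le_abs_self _))
    simp [hx, hy, hz, ht]
  have h2 : ‖x' + a • y' + b • z' + c • t'‖ ≤ ‖x'‖ + a * ‖y'‖ + b * ‖z'‖ + c * ‖t'‖ := by
    refine (norm_add_le _ _).trans ?_
    refine add_le_add ((norm_add_le _ _).trans
      (add_le_add ((norm_add_le _ _).trans (add_le_add le_rfl ?_)) ?_)) ?_
    all_goals rw [norm_smul, Real.norm_of_nonneg (by assumption)]
  refine h1.trans (h2.trans ?_)
  gcongr

lemma aux_inv_sqrt (ε s s' : ℝ) (hε : 0 < ε) (hs : ε ≤ s) (hs' : ε ≤ s') :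
    |1 / √s - 1 / √s'| ≤ |s - s'| / (2 * ε * √ε) := by
  have e : 0 < √ε := Real.sqrt_pos.2 hε
  have p : √ε ≤ √s := Real.sqrt_le_sqrt hs
  have q : √ε ≤ √s' := Real.sqrt_le_sqrt hs'
  have p0 : 0 < √s := e.trans_le p
  have q0 : 0 < √s' := e.trans_le q
  have k : 1 / √s - 1 / √s' = -(s - s') / (√s * √s' * (√s + √s')) := by
    have h1 : s = √s ^ 2 := (Real.sq_sqrt (by linarith)).symm
    have h2 : s' = √s' ^ 2 := (Real.sq_sqrt (by linarith)).symm
    have : -(s - s') = (√s' - √s) * (√s + √s') := by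
      linear_combination (-1) * h1 + h2
    rw [this]
    field_simp
  rw [k, abs_div, abs_neg, abs_of_pos (a := √s * √s' * (√s + √s')) (by positivity)]
  apply div_le_div_of_nonneg_left (abs_nonneg _) (by positivity)
  calc 2 * ε * √ε = √ε * √ε * (√ε + √ε) := by
        rw [Real.mul_self_sqrt hε.le]; ring
    _ ≤ _ := by gcongr

lemma aux_coord (β₁ β₂ η ε G M M' V V' W W' γ γ' : ℝ)
    (hβ₁0 : 0 ≤ β₁) (hβ₁1 : β₁ < 1) (hβ₂0 : 0 ≤ β₂) (hβ₂1 : β₂ < 1)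
    (hη : 0 < η) (hε : 0 < ε) (hG : 0 < G) (hM' : |M'| ≤ G)
    (hV : 0 ≤ V) (hV' : 0 ≤ V') (hγ : |γ| ≤ G) (hγ' : |γ'| ≤ G) :
    |(W - η * (β₁ * M + (1 - β₁) * γ) / √(β₂ * V + (1 - β₂) * γ ^ 2 + ε)) -
      (W' - η * (β₁ * M' + (1 - β₁) * γ') / √(β₂ * V' + (1 - β₂) * γ' ^ 2 + ε))| ≤
    |W - W'| + η * β₁ / √ε * |M - M'| + G * η * β₂ / (2 * ε * √ε) * |V - V'|
      + (η / √ε * (1 - β₁) + G ^ 2 * η / (ε * √ε) * (1 - β₂)) * |γ - γ'| := by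
  have b1 : 0 ≤ 1 - β₁ := by linarith
  have b2 : 0 ≤ 1 - β₂ := by linarith
  set s := β₂ * V + (1 - β₂) * γ ^ 2 + ε with hs
  set s' := β₂ * V' + (1 - β₂) * γ' ^ 2 + ε with hs'
  have es : ε ≤ s := by have : 0 ≤ β₂ * V + (1 - β₂) * γ ^ 2 := by positivity
                        linarith
  have es' : ε ≤ s' := by have : 0 ≤ β₂ * V' + (1 - β₂) * γ' ^ 2 := by positivity
                          linarith
  have e : 0 < √ε := Real.sqrt_pos.2 hε
  have p : √ε ≤ √s := Real.sqrt_le_sqrt es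
  have key := aux_inv_sqrt ε s s' hε es es'
  have hd : |s - s'| ≤ β₂ * |V - V'| + (1 - β₂) * (2 * G * |γ - γ'|) := by
    have : s - s' = β₂ * (V - V') + (1 - β₂) * ((γ + γ') * (γ - γ')) := by
      rw [hs, hs']; ring
    rw [this]
    refine (abs_add_le _ _).trans ?_
    rw [abs_mul, abs_mul, abs_mul, abs_of_nonneg hβ₂0, abs_of_nonneg b2]
    have : |γ + γ'| ≤ 2 * G := (abs_add_le _ _).trans (by linarith)
    gcongr
  have hm : |(β₁ * M + (1 - β₁) * γ) - (β₁ * M' + (1 - β₁) * γ')| ≤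
      β₁ * |M - M'| + (1 - β₁) * |γ - γ'| := by
    have : (β₁ * M + (1 - β₁) * γ) - (β₁ * M' + (1 - β₁) * γ') =
      β₁ * (M - M') + (1 - β₁) * (γ - γ') := by ring
    rw [this]
    refine (abs_add_le _ _).trans ?_
    rw [abs_mul, abs_mul, abs_of_nonneg hβ₁0, abs_of_nonneg b1]
  have hm' : |β₁ * M' + (1 - β₁) * γ'| ≤ G := by
    refine (abs_add_le _ _).trans ?_
    rw [abs_mul, abs_mul, abs_of_nonneg hβ₁0, abs_of_nonneg b1]
    nlinarith
  set m := β₁ * M + (1 - β₁) * γ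
  set m' := β₁ * M' + (1 - β₁) * γ'
  have dec : (W - η * m / √s) - (W' - η * m' / √s') =
      (W - W') + (-(η * ((m - m') / √s)) + -(η * (m' * (1 / √s - 1 / √s')))) := by ring
  rw [dec]
  refine (abs_add_le _ _).trans ?_
  have t1 : |(m - m') / √s| ≤ (β₁ * |M - M'| + (1 - β₁) * |γ - γ'|) / √ε := by
    rw [abs_div, abs_of_nonneg (Real.sqrt_nonneg s)]
    gcongr
  have t2 : |m' * (1 / √s - 1 / √s')| ≤
      G * ((β₂ * |V - V'| + (1 - β₂) * (2 * G * |γ - γ'|)) / (2 * ε * √ε)) := by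
    rw [abs_mul]
    refine mul_le_mul hm' (key.trans ?_) (abs_nonneg _) hG.le
    gcongr
  have t3 := abs_add_le (-(η * ((m - m') / √s))) (-(η * (m' * (1 / √s - 1 / √s'))))
  rw [abs_neg, abs_neg, abs_mul, abs_mul, abs_of_pos hη] at t3
  have t4 := mul_le_mul_of_nonneg_left t1 hη.le
  have t5 := mul_le_mul_of_nonneg_left t2 hη.le
  have fin : η * ((β₁ * |M - M'| + (1 - β₁) * |γ - γ'|) / √ε) +
      η * (G * ((β₂ * |V - V'| + (1 - β₂) * (2 * G * |γ - γ'|)) / (2 * ε * √ε))) =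
      η * β₁ / √ε * |M - M'| + G * η * β₂ / (2 * ε * √ε) * |V - V'|
      + (η / √ε * (1 - β₁) + G ^ 2 * η / (ε * √ε) * (1 - β₂)) * |γ - γ'| := by
    field_simp
    ring
  linarith


/-- **Lemma 5 (one-step Adam deviation bound).**
One Adam epoch starting from `(M, V, W)` with the stochastic gradient `g̃`, versus
one Adam epoch starting from `(M̆, V̆, W̆)` with the global gradient `g`, where `g_n`
is `ρ`-Lipschitz, all gradient coordinates are bounded by `G`, `‖g̃ − g_n‖ ≤ σ_l/√D̃`
and `‖g_n − g‖ ≤ σ_g` pointwise. -/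
theorem one_step_adam_deviation (d : ℕ) (hd : 1 ≤ d)
    (β₁ β₂ η ε ρ G σl σg Dt : ℝ)
    (hβ₁0 : 0 ≤ β₁) (hβ₁1 : β₁ < 1) (hβ₂0 : 0 ≤ β₂) (hβ₂1 : β₂ < 1)
    (hη : 0 < η) (hε : 0 < ε) (hρ : 0 ≤ ρ) (hG : 0 < G)
    (hσl : 0 ≤ σl) (hσg : 0 ≤ σg) (hD : 0 < Dt)
    (gt gn g : EuclideanSpace ℝ (Fin d) → EuclideanSpace ℝ (Fin d))
    (hlip : ∀ a b, ‖gn a - gn b‖ ≤ ρ * ‖a - b‖)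
    (hbdt : ∀ x j, |gt x j| ≤ G) (hbdn : ∀ x j, |gn x j| ≤ G)
    (hbdg : ∀ x j, |g x j| ≤ G)
    (hloc : ∀ x, ‖gt x - gn x‖ ≤ σl / Real.sqrt Dt)
    (hglob : ∀ x, ‖gn x - g x‖ ≤ σg)
    (M V W Mb Vb Wb : EuclideanSpace ℝ (Fin d))
    (hM : ∀ j, |M j| ≤ G) (hMb : ∀ j, |Mb j| ≤ G)
    (hV : ∀ j, 0 ≤ V j) (hVb : ∀ j, 0 ≤ Vb j)
    (w1 wc1 : EuclideanSpace ℝ (Fin d))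
    (hw1 : ∀ j, w1 j = W j -
      η * (β₁ * M j + (1 - β₁) * gt W j) /
        Real.sqrt (β₂ * V j + (1 - β₂) * (gt W j) ^ 2 + ε))
    (hwc1 : ∀ j, wc1 j = Wb j -
      η * (β₁ * Mb j + (1 - β₁) * g Wb j) /
        Real.sqrt (β₂ * Vb j + (1 - β₂) * (g Wb j) ^ 2 + ε)) :
    ‖w1 - wc1‖ ≤
      (1 + η * ρ / Real.sqrt ε * (1 - β₁)
          + d * G ^ 2 * η * ρ / (ε * Real.sqrt ε) * (1 - β₂)) * ‖W - Wb‖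
        + η * β₁ / Real.sqrt ε * ‖M - Mb‖
        + Real.sqrt d * G * η * β₂ / (2 * ε * Real.sqrt ε) * ‖V - Vb‖
        + (η / Real.sqrt ε * (1 - β₁) + d * G ^ 2 * η / (ε * Real.sqrt ε) * (1 - β₂)) *
            (σl / Real.sqrt Dt + σg) := by

  have b1 : 0 ≤ 1 - β₁ := by linarith
  have b2 : 0 ≤ 1 - β₂ := by linarith
  have e : 0 < √ε := Real.sqrt_pos.2 hε
  have d1 : (1 : ℝ) ≤ d := by exact_mod_cast hd
  have d2 : 1 ≤ √(d : ℝ) := by rw [Real.one_le_sqrt]; exact d1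
  have hΔ : ‖gt W - g Wb‖ ≤ ρ * ‖W - Wb‖ + (σl / √Dt + σg) := by
    have : gt W - g Wb = (gt W - gn W) + (gn W - gn Wb) + (gn Wb - g Wb) := by abel
    rw [this]
    have h1 := norm_add₃_le (a := gt W - gn W) (b := gn W - gn Wb) (c := gn Wb - g Wb)
    linarith [hloc W, hlip W Wb, hglob Wb]
  have main := aux_comb (w1 - wc1) (W - Wb) (M - Mb) (V - Vb) (gt W - g Wb)
    (η * β₁ / √ε) (G * η * β₂ / (2 * ε * √ε))
    (η / √ε * (1 - β₁) + G ^ 2 * η / (ε * √ε) * (1 - β₂))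
    (by positivity) (by positivity) (by positivity) (by
      intro j
      simp only [PiLp.sub_apply]
      rw [hw1, hwc1]
      exact aux_coord β₁ β₂ η ε G _ _ _ _ _ _ _ _ hβ₁0 hβ₁1 hβ₂0 hβ₂1 hη hε hG (hMb j)
        (hV j) (hVb j) (hbdt W j) (hbdg Wb j))
  have hS : 0 ≤ σl / √Dt + σg := by positivity
  have c1 : G * η * β₂ / (2 * ε * √ε) ≤ √(d : ℝ) * G * η * β₂ / (2 * ε * √ε) := by
    have : 0 ≤ G * η * β₂ / (2 * ε * √ε) := by positivity
    calc _ ≤ √(d : ℝ) * (G * η * β₂ / (2 * ε * √ε)) := le_mul_of_one_le_left this d2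
      _ = _ := by ring
  have c2 : G ^ 2 * η / (ε * √ε) * (1 - β₂) ≤ d * G ^ 2 * η / (ε * √ε) * (1 - β₂) := by
    have : 0 ≤ G ^ 2 * η / (ε * √ε) * (1 - β₂) := by positivity
    calc _ ≤ (d : ℝ) * (G ^ 2 * η / (ε * √ε) * (1 - β₂)) := le_mul_of_one_le_left this d1
      _ = _ := by ring
  have f1 := mul_le_mul_of_nonneg_right c1 (norm_nonneg (V - Vb))
  have f2 : (η / √ε * (1 - β₁) + G ^ 2 * η / (ε * √ε) * (1 - β₂)) * ‖gt W - g Wb‖ ≤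
      (η / √ε * (1 - β₁) + d * G ^ 2 * η / (ε * √ε) * (1 - β₂)) *
        (ρ * ‖W - Wb‖ + (σl / √Dt + σg)) :=
    mul_le_mul (by linarith) hΔ (norm_nonneg _) (by positivity)
  refine (main.trans (add_le_add (add_le_add le_rfl f1) f2)).trans (le_of_eq ?_)
  ring
end

section
/- In the FedAdam-SSM setup with β₂ > 0, together with the centralized-Adam auxiliary iterates, define φ = β₁/√β₂, ψ = 1 + β₁/√β₂ + (ηρ(1−β₁)/√ε)(1 + (1−β₂)dG²/ε), and χ_n = dGη( 2β₁(1−√β₂)(G²+ε)/(ε√(εβ₂)) + (1−β₁)β₂G²/(ε√ε) ) + ((1−β₁)η/√ε)(σ_l/√D̃_n + σ_g)(1 + (1−β₂)dG²/ε). Then for every device n, every round t ≥ 0 and every epoch index l with 0 ≤ l ≤ L−2, ‖w_n^{l+2,t} − w̌^{l+2,t}‖ ≤ ψ ‖w_n^{l+1,t} − w̌^{l+1,t}‖ + φ ‖w_n^{l,t} − w̌^{l,t}‖ + χ_n. -/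
lemma fa_inv_sqrt (a b a' b' : ℝ) (ha' : 0 < a') (hb' : 0 < b') (ha : a' ≤ a) (hb : b' ≤ b) :
    |1 / √a - 1 / √b| ≤ |a - b| / (√a' * √b' * (√a' + √b')) := by
  have h1 : 0 < √a' := Real.sqrt_pos.2 ha'
  have h2 : 0 < √b' := Real.sqrt_pos.2 hb'
  have h3 : √a' ≤ √a := Real.sqrt_le_sqrt ha
  have h4 : √b' ≤ √b := Real.sqrt_le_sqrt hb
  have h5 : 0 < √a := h1.trans_le h3
  have h6 : 0 < √b := h2.trans_le h4
  have e1 : a = √a ^ 2 := (Real.sq_sqrt (by linarith)).symm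
  have e2 : b = √b ^ 2 := (Real.sq_sqrt (by linarith)).symm
  have e : 1 / √a - 1 / √b = (b - a) / (√a * √b * (√a + √b)) := by
    rw [show b - a = √b ^ 2 - √a ^ 2 by rw [← e1, ← e2]]
    field_simp
    ring
  rw [e, abs_div, abs_sub_comm b a, abs_of_pos (show 0 < √a * √b * (√a + √b) by positivity)]
  gcongr

lemma fa_norm (d : ℕ) (e h : EuclideanSpace ℝ (Fin d)) (A B : ℝ) (hA : 0 ≤ A) (hB : 0 ≤ B)
    (he : ∀ j, |e j| ≤ A + B * |h j|) : ‖e‖ ≤ d * A + B * ‖h‖ := by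
  let c : EuclideanSpace ℝ (Fin d) := WithLp.toLp 2 (fun _ => A)
  let k : EuclideanSpace ℝ (Fin d) := WithLp.toLp 2 (fun j => |h j|)
  have hk : ‖k‖ = ‖h‖ := by
    simp [EuclideanSpace.norm_eq, k]
  have hc : ‖c‖ ≤ d * A := by
    rw [EuclideanSpace.norm_eq]
    apply Real.sqrt_le_iff.2
    refine ⟨by positivity, ?_⟩
    simp only [c, Real.norm_eq_abs, sq_abs, Finset.sum_const, Finset.card_univ, Fintype.card_fin,
      nsmul_eq_mul, mul_pow]
    have : (d : ℝ) ≤ (d : ℝ) ^ 2 := by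
      exact_mod_cast Nat.le_self_pow (by norm_num) d
    gcongr
  have h1 : ‖e‖ ≤ ‖c + B • k‖ := by
    rw [EuclideanSpace.norm_eq, EuclideanSpace.norm_eq]
    apply Real.sqrt_le_sqrt
    apply Finset.sum_le_sum
    intro j _
    have : (c + B • k) j = A + B * |h j| := by simp [c, k]
    rw [this, Real.norm_eq_abs, Real.norm_eq_abs]
    have := he j
    exact pow_le_pow_left₀ (abs_nonneg _) (this.trans (le_abs_self _)) 2
  calc ‖e‖ ≤ ‖c‖ + ‖B • k‖ := h1.trans (norm_add_le _ _)
    _ ≤ d * A + B * ‖h‖ := by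
      rw [norm_smul, hk, Real.norm_of_nonneg hB]; linarith

lemma fa_conv {N : ℕ} (lam s y : Fin N → ℝ) (x a b : ℝ) (h0 : ∀ n, 0 ≤ lam n)
    (h1 : ∑ n, lam n = 1) (hs : ∀ n, s n = 0 ∨ s n = 1) (hx : a ≤ x ∧ x ≤ b)
    (hy : ∀ n, a ≤ y n ∧ y n ≤ b) :
    a ≤ x + ∑ n, lam n * (s n * (y n - x)) ∧ x + ∑ n, lam n * (s n * (y n - x)) ≤ b := by
  have e : x + ∑ n, lam n * (s n * (y n - x)) = ∑ n, lam n * (x + s n * (y n - x)) := by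
    simp only [mul_add, Finset.sum_add_distrib, ← Finset.sum_mul, h1, one_mul]
  have hz : ∀ n, a ≤ x + s n * (y n - x) ∧ x + s n * (y n - x) ≤ b := by
    intro n
    rcases hs n with h | h <;> rw [h]
    · simpa using hx
    · simpa using hy n
  rw [e]
  constructor
  · calc a = ∑ n, lam n * a := by rw [← Finset.sum_mul, h1, one_mul]
      _ ≤ _ := Finset.sum_le_sum fun n _ => mul_le_mul_of_nonneg_left (hz n).1 (h0 n)
  · calc _ ≤ ∑ n, lam n * b :=
        Finset.sum_le_sum fun n _ => mul_le_mul_of_nonneg_left (hz n).2 (h0 n)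
      _ = b := by rw [← Finset.sum_mul, h1, one_mul]

lemma fa_avg (β x y a b : ℝ) (h0 : 0 ≤ β) (h1 : β < 1) (hx : a ≤ x ∧ x ≤ b)
    (hy : a ≤ y ∧ y ≤ b) : a ≤ β * x + (1 - β) * y ∧ β * x + (1 - β) * y ≤ b := by
  constructor <;> nlinarith [hx.1, hx.2, hy.1, hy.2]

/-- momentum error -/
lemma fa_mom (β₂ ε G v g m : ℝ) (hβ₂0 : 0 < β₂) (hβ₂1 : β₂ < 1) (hε : 0 < ε) (hG : 0 < G)
    (hv : 0 ≤ v) (hg : |g| ≤ G) (hm : |m| ≤ G) :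
    |m / √(β₂ * v + (1 - β₂) * g ^ 2 + ε) - 1 / √β₂ * (m / √(v + ε))| ≤
      G * ((1 - √β₂) * (G ^ 2 + ε) / (ε * √(ε * β₂))) := by
  have hb := Real.sqrt_pos.2 hβ₂0
  have he := Real.sqrt_pos.2 hε
  have hg2 : g ^ 2 ≤ G ^ 2 := sq_le_sq.2 (by rwa [abs_of_pos hG])
  have key := fa_inv_sqrt (β₂ * v + (1 - β₂) * g ^ 2 + ε) (β₂ * (v + ε)) ε (ε * β₂) hε
    (by positivity) (by nlinarith [mul_nonneg hβ₂0.le hv, mul_nonneg (sub_pos.2 hβ₂1).le (sq_nonneg g)])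
    (by nlinarith [mul_nonneg hβ₂0.le hv])
  have e1 : m / √(β₂ * v + (1 - β₂) * g ^ 2 + ε) - 1 / √β₂ * (m / √(v + ε)) =
      m * (1 / √(β₂ * v + (1 - β₂) * g ^ 2 + ε) - 1 / √(β₂ * (v + ε))) := by
    rw [Real.sqrt_mul hβ₂0.le]
    ring
  have e2 : |β₂ * v + (1 - β₂) * g ^ 2 + ε - β₂ * (v + ε)| ≤ (1 - β₂) * (G ^ 2 + ε) := by
    rw [show β₂ * v + (1 - β₂) * g ^ 2 + ε - β₂ * (v + ε) = (1 - β₂) * (g ^ 2 + ε) by ring]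
    have : 0 < 1 - β₂ := by linarith
    rw [abs_of_nonneg (by positivity)]
    gcongr
  have hs : √β₂ < 1 := by rw [Real.sqrt_lt' one_pos]; simpa using hβ₂1
  rw [e1, abs_mul]
  apply mul_le_mul hm _ (abs_nonneg _) hG.le
  refine key.trans ((div_le_div_of_nonneg_right e2 (by positivity)).trans (le_of_eq ?_))
  rw [Real.sqrt_mul hε.le, show 1 - β₂ = (1 - √β₂) * (1 + √β₂) by
    nlinarith [Real.sq_sqrt hβ₂0.le]]
  rw [show √ε * (√ε * √β₂) * (√ε + √ε * √β₂) = (√ε ^ 2) * (√ε * √β₂) * (1 + √β₂) by ring,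
    Real.sq_sqrt hε.le]
  field_simp

/-- gradient error -/
lemma fa_grad (β₂ ε G v vc g gc : ℝ) (hβ₂0 : 0 < β₂) (hβ₂1 : β₂ < 1) (hε : 0 < ε) (hG : 0 < G)
    (hv : 0 ≤ v ∧ v ≤ G ^ 2) (hvc : 0 ≤ vc ∧ vc ≤ G ^ 2) (hg : |g| ≤ G) (hgc : |gc| ≤ G) :
    |g / √(β₂ * v + (1 - β₂) * g ^ 2 + ε) - gc / √(β₂ * vc + (1 - β₂) * gc ^ 2 + ε)| ≤
      G * (β₂ * G ^ 2 / (ε * √ε)) + 1 / √ε * (1 + (1 - β₂) * G ^ 2 / ε) * |g - gc| := by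
  have he := Real.sqrt_pos.2 hε
  have hb : 0 < 1 - β₂ := by linarith
  have p1 : ε ≤ β₂ * v + (1 - β₂) * g ^ 2 + ε := by
    have := hv.1
    have : 0 ≤ β₂ * v + (1 - β₂) * g ^ 2 := by positivity
    linarith
  have p2 : ε ≤ β₂ * vc + (1 - β₂) * gc ^ 2 + ε := by
    have := hvc.1
    have : 0 ≤ β₂ * vc + (1 - β₂) * gc ^ 2 := by positivity
    linarith
  have key := fa_inv_sqrt _ _ ε ε hε hε p1 p2
  have hd : |β₂ * v + (1 - β₂) * g ^ 2 + ε - (β₂ * vc + (1 - β₂) * gc ^ 2 + ε)| ≤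
      β₂ * G ^ 2 + (1 - β₂) * (2 * G * |g - gc|) := by
    rw [show β₂ * v + (1 - β₂) * g ^ 2 + ε - (β₂ * vc + (1 - β₂) * gc ^ 2 + ε) =
      β₂ * (v - vc) + (1 - β₂) * ((g + gc) * (g - gc)) by ring]
    refine (abs_add_le _ _).trans ?_
    rw [abs_mul, abs_mul, abs_mul, abs_of_pos hβ₂0, abs_of_pos hb]
    have h1 : |v - vc| ≤ G ^ 2 := abs_le.2 ⟨by linarith [hv.1, hvc.2], by linarith [hv.2, hvc.1]⟩
    have h2 : |g + gc| ≤ 2 * G := (abs_add_le _ _).trans (by linarith)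
    gcongr
  set a := β₂ * v + (1 - β₂) * g ^ 2 + ε
  set b := β₂ * vc + (1 - β₂) * gc ^ 2 + ε
  have hs : 1 / √a ≤ 1 / √ε := one_div_le_one_div_of_le he (Real.sqrt_le_sqrt p1)
  have hp : 0 ≤ 1 / √a := by positivity
  rw [show g / √a - gc / √b = (1 / √a) * (g - gc) + gc * (1 / √a - 1 / √b) by ring]
  refine (abs_add_le _ _).trans ?_
  rw [abs_mul, abs_mul, abs_of_nonneg hp]
  have k2 : |1 / √a - 1 / √b| ≤
      (β₂ * G ^ 2 + (1 - β₂) * (2 * G * |g - gc|)) / (2 * (ε * √ε)) := by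
    refine key.trans ?_
    rw [show √ε * √ε * (√ε + √ε) = 2 * (ε * √ε) by rw [Real.mul_self_sqrt hε.le]; ring]
    gcongr
  have t1 := mul_le_mul_of_nonneg_right hs (abs_nonneg (g - gc))
  have t2 := mul_le_mul hgc k2 (abs_nonneg _) hG.le
  have t3 : 0 ≤ G * (β₂ * G ^ 2 / (ε * √ε)) := by positivity
  have e : G * ((β₂ * G ^ 2 + (1 - β₂) * (2 * G * |g - gc|)) / (2 * (ε * √ε))) =
    1 / 2 * (G * (β₂ * G ^ 2 / (ε * √ε))) + 1 / √ε * ((1 - β₂) * G ^ 2 / ε) * |g - gc| := by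
    field_simp
  rw [e] at t2
  nlinarith

lemma fa_scalar (β₁ β₂ η ε G w w1 m v g w2 c c1 mc vc gc c2 : ℝ)
    (hβ₁0 : 0 ≤ β₁) (hβ₁1 : β₁ < 1) (hβ₂0 : 0 < β₂) (hβ₂1 : β₂ < 1)
    (hη : 0 < η) (hε : 0 < ε) (hG : 0 < G)
    (hv : 0 ≤ v ∧ v ≤ G ^ 2) (hvc : 0 ≤ vc ∧ vc ≤ G ^ 2) (hg : |g| ≤ G) (hgc : |gc| ≤ G)
    (hm : |m| ≤ G) (hmc : |mc| ≤ G)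
    (hw1 : w1 = w - η * m / √(v + ε)) (hc1 : c1 = c - η * mc / √(vc + ε))
    (hw2 : w2 = w1 - η * (β₁ * m + (1 - β₁) * g) / √(β₂ * v + (1 - β₂) * g ^ 2 + ε))
    (hc2 : c2 = c1 - η * (β₁ * mc + (1 - β₁) * gc) / √(β₂ * vc + (1 - β₂) * gc ^ 2 + ε)) :
    |(w2 - c2) - (1 + β₁ / √β₂) * (w1 - c1) + β₁ / √β₂ * (w - c)| ≤
      G * η * (2 * β₁ * (1 - √β₂) * (G ^ 2 + ε) / (ε * √(ε * β₂))
          + (1 - β₁) * β₂ * G ^ 2 / (ε * √ε))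
      + (1 - β₁) * η / √ε * (1 + (1 - β₂) * G ^ 2 / ε) * |g - gc| := by
  have a1 := fa_mom β₂ ε G v g m hβ₂0 hβ₂1 hε hG hv.1 hg hm
  have a2 := fa_mom β₂ ε G vc gc mc hβ₂0 hβ₂1 hε hG hvc.1 hgc hmc
  have a3 := fa_grad β₂ ε G v vc g gc hβ₂0 hβ₂1 hε hG hv hvc hg hgc
  have hb : 0 ≤ (1 - β₁) := by linarith
  set P := m / √(β₂ * v + (1 - β₂) * g ^ 2 + ε) - 1 / √β₂ * (m / √(v + ε)) with hP
  set Q := mc / √(β₂ * vc + (1 - β₂) * gc ^ 2 + ε) - 1 / √β₂ * (mc / √(vc + ε)) with hQ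
  set R := g / √(β₂ * v + (1 - β₂) * g ^ 2 + ε) - gc / √(β₂ * vc + (1 - β₂) * gc ^ 2 + ε) with hR
  have e : (w2 - c2) - (1 + β₁ / √β₂) * (w1 - c1) + β₁ / √β₂ * (w - c) =
      (η * β₁) * Q - (η * β₁) * P - (η * (1 - β₁)) * R := by
    rw [hw2, hc2, hw1, hc1, hP, hQ, hR]
    ring
  rw [e]
  have b1 := mul_le_mul_of_nonneg_left a1 (mul_nonneg hη.le hβ₁0)
  have b2 := mul_le_mul_of_nonneg_left a2 (mul_nonneg hη.le hβ₁0)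
  have b3 := mul_le_mul_of_nonneg_left a3 (mul_nonneg hη.le hb)
  calc _ ≤ |(η * β₁) * Q| + |(η * β₁) * P| + |(η * (1 - β₁)) * R| :=
        (abs_sub _ _).trans (by gcongr; exact abs_sub _ _)
    _ = (η * β₁) * |Q| + (η * β₁) * |P| + (η * (1 - β₁)) * |R| := by
      rw [abs_mul (η * β₁) Q, abs_mul (η * β₁) P, abs_mul (η * (1 - β₁)), abs_of_nonneg (mul_nonneg hη.le hβ₁0),
        abs_of_nonneg (mul_nonneg hη.le hb)]
    _ ≤ _ := add_le_add (add_le_add b2 b1) b3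
    _ = _ := by ring

/-- **Lemma 4 (two-step recurrence for the FedAdam-SSM / centralized-Adam deviation).**
In the FedAdam-SSM setup with `β₂ > 0`, with the centralized-Adam auxiliary iterates,
for constants `φ = β₁/√β₂`, `ψ = 1 + β₁/√β₂ + (ηρ(1−β₁)/√ε)(1 + (1−β₂)dG²/ε)` and
`χ_n` as in the paper, for every device `n`, round `t` and epoch `l ≤ L − 2`,
`‖w_n^{l+2,t} − w̌^{l+2,t}‖ ≤ ψ‖w_n^{l+1,t} − w̌^{l+1,t}‖ + φ‖w_n^{l,t} − w̌^{l,t}‖ + χ_n`. -/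
theorem fedadam_ssm_deviation_recurrence
    (d N L : ℕ) (hd : 1 ≤ d) (hN : 1 ≤ N) (hL : 1 ≤ L)
    (β₁ β₂ η ε G ρ σl σg : ℝ)
    (hβ₁0 : 0 ≤ β₁) (hβ₁1 : β₁ < 1) (hβ₂0 : 0 < β₂) (hβ₂1 : β₂ < 1)
    (hη : 0 < η) (hε : 0 < ε) (hG : 0 < G) (hρ : 0 ≤ ρ) (hσl : 0 ≤ σl) (hσg : 0 ≤ σg)
    (Dt : Fin N → ℝ) (hDt : ∀ n, 0 < Dt n)
    (lam : Fin N → ℝ) (hlam : ∀ n, lam n = Dt n / ∑ p, Dt p)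
    -- gradient maps
    (gradFt : Fin N → ℕ → ℕ → EuclideanSpace ℝ (Fin d) → EuclideanSpace ℝ (Fin d))
    (gradFn : Fin N → EuclideanSpace ℝ (Fin d) → EuclideanSpace ℝ (Fin d))
    (gradF : EuclideanSpace ℝ (Fin d) → EuclideanSpace ℝ (Fin d))
    -- (A1) ρ-Lipschitz continuity
    (hlip1 : ∀ n l t x y, ‖gradFt n l t x - gradFt n l t y‖ ≤ ρ * ‖x - y‖)
    (hlip2 : ∀ n x y, ‖gradFn n x - gradFn n y‖ ≤ ρ * ‖x - y‖)
    (hlip3 : ∀ x y, ‖gradF x - gradF y‖ ≤ ρ * ‖x - y‖)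
    -- (A2) bounded gradients
    (hbd1 : ∀ n l t x j, |gradFt n l t x j| ≤ G)
    (hbd2 : ∀ n x j, |gradFn n x j| ≤ G)
    (hbd3 : ∀ x j, |gradF x j| ≤ G)
    -- (A3) bounded gradient variances
    (hvar1 : ∀ n l t x, ‖gradFt n l t x - gradFn n x‖ ≤ σl / Real.sqrt (Dt n))
    (hvar2 : ∀ n x, ‖gradFn n x - gradF x‖ ≤ σg)
    -- FedAdam-SSM iterates
    (M V W : ℕ → EuclideanSpace ℝ (Fin d))
    (m v w : Fin N → ℕ → ℕ → EuclideanSpace ℝ (Fin d))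
    (hM0 : M 0 = 0) (hV0 : V 0 = 0)
    (hm0 : ∀ n t, m n 0 t = M t) (hv0 : ∀ n t, v n 0 t = V t)
    (hw0 : ∀ n t, w n 0 t = W t)
    (hmrec : ∀ n l t, l < L → ∀ j,
      m n (l + 1) t j = β₁ * m n l t j + (1 - β₁) * gradFt n (l + 1) t (w n l t) j)
    (hvrec : ∀ n l t, l < L → ∀ j,
      v n (l + 1) t j = β₂ * v n l t j + (1 - β₂) * (gradFt n (l + 1) t (w n l t) j) ^ 2)
    (hwrec : ∀ n l t, l < L → ∀ j,
      w n (l + 1) t j = w n l t j - η * m n (l + 1) t j / Real.sqrt (v n (l + 1) t j + ε))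
    (s : Fin N → ℕ → Fin d → ℝ) (hs : ∀ n t j, s n t j = 0 ∨ s n t j = 1)
    (hMagg : ∀ t j, M (t + 1) j = M t j + ∑ n, lam n * (s n t j * (m n L t j - M t j)))
    (hVagg : ∀ t j, V (t + 1) j = V t j + ∑ n, lam n * (s n t j * (v n L t j - V t j)))
    (hWagg : ∀ t j, W (t + 1) j = W t j + ∑ n, lam n * (s n t j * (w n L t j - W t j)))
    -- non-sparse global aggregates
    (Mb Vb Wb : ℕ → EuclideanSpace ℝ (Fin d))
    (hMb0 : Mb 0 = 0) (hVb0 : Vb 0 = 0) (hWb0 : Wb 0 = W 0)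
    (hMb : ∀ t j, Mb (t + 1) j = M t j + ∑ n, lam n * (m n L t j - M t j))
    (hVb : ∀ t j, Vb (t + 1) j = V t j + ∑ n, lam n * (v n L t j - V t j))
    (hWb : ∀ t j, Wb (t + 1) j = W t j + ∑ n, lam n * (w n L t j - W t j))
    -- centralized-Adam auxiliary iterates
    (mc vc wc : ℕ → ℕ → EuclideanSpace ℝ (Fin d))
    (hmc0 : ∀ t, mc 0 t = Mb t) (hvc0 : ∀ t, vc 0 t = Vb t) (hwc0 : ∀ t, wc 0 t = Wb t)
    (hmcrec : ∀ l t j, mc (l + 1) t j = β₁ * mc l t j + (1 - β₁) * gradF (wc l t) j)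
    (hvcrec : ∀ l t j, vc (l + 1) t j = β₂ * vc l t j + (1 - β₂) * (gradF (wc l t) j) ^ 2)
    (hwcrec : ∀ l t j,
      wc (l + 1) t j = wc l t j - η * mc (l + 1) t j / Real.sqrt (vc (l + 1) t j + ε))
    -- the constants
    (φ ψ : ℝ) (χ : Fin N → ℝ)
    (hφ : φ = β₁ / Real.sqrt β₂)
    (hψ : ψ = 1 + β₁ / Real.sqrt β₂
      + η * ρ * (1 - β₁) / Real.sqrt ε * (1 + (1 - β₂) * d * G ^ 2 / ε))
    (hχ : ∀ n, χ n = d * G * η *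
        (2 * β₁ * (1 - Real.sqrt β₂) * (G ^ 2 + ε) / (ε * Real.sqrt (ε * β₂))
          + (1 - β₁) * β₂ * G ^ 2 / (ε * Real.sqrt ε))
      + (1 - β₁) * η / Real.sqrt ε * (σl / Real.sqrt (Dt n) + σg) *
          (1 + (1 - β₂) * d * G ^ 2 / ε)) :
    ∀ (n : Fin N) (t l : ℕ), l + 2 ≤ L →
      ‖w n (l + 2) t - wc (l + 2) t‖ ≤
        ψ * ‖w n (l + 1) t - wc (l + 1) t‖ + φ * ‖w n l t - wc l t‖ + χ n := by
  have hNe : Nonempty (Fin N) := ⟨⟨0, by omega⟩⟩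
  have hS : 0 < ∑ p, Dt p := Finset.sum_pos (fun n _ => hDt n) Finset.univ_nonempty
  have hl0 : ∀ n, 0 ≤ lam n := fun n => by rw [hlam]; exact (div_pos (hDt n) hS).le
  have hl1 : ∑ n, lam n = 1 := by
    simp only [hlam]
    rw [← Finset.sum_div, div_self hS.ne']
  have sqb : ∀ x : ℝ, |x| ≤ G → 0 ≤ x ^ 2 ∧ x ^ 2 ≤ G ^ 2 := fun x hx =>
    ⟨sq_nonneg x, sq_le_sq.2 (by rwa [abs_of_pos hG])⟩
  -- local invariants
  have locm : ∀ t, (∀ j, -G ≤ M t j ∧ M t j ≤ G) →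
      ∀ n l, l ≤ L → ∀ j, -G ≤ m n l t j ∧ m n l t j ≤ G := by
    intro t h n l
    induction l with
    | zero => intro _ j; rw [hm0]; exact h j
    | succ l ih =>
      intro hl j
      rw [hmrec n l t (by omega) j]
      exact fa_avg _ _ _ _ _ hβ₁0 hβ₁1 (ih (by omega) j) (abs_le.1 (hbd1 _ _ _ _ _))
  have locv : ∀ t, (∀ j, 0 ≤ V t j ∧ V t j ≤ G ^ 2) →
      ∀ n l, l ≤ L → ∀ j, 0 ≤ v n l t j ∧ v n l t j ≤ G ^ 2 := by
    intro t h n l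
    induction l with
    | zero => intro _ j; rw [hv0]; exact h j
    | succ l ih =>
      intro hl j
      rw [hvrec n l t (by omega) j]
      exact fa_avg _ _ _ _ _ hβ₂0.le hβ₂1 (ih (by omega) j) (sqb _ (hbd1 _ _ _ _ _))
  have gM : ∀ t j, -G ≤ M t j ∧ M t j ≤ G := by
    intro t
    induction t with
    | zero => intro j; rw [hM0]; simp [hG.le]
    | succ t ih =>
      intro j
      rw [hMagg]
      exact fa_conv lam (fun n => s n t j) (fun n => m n L t j) _ _ _ hl0 hl1
        (fun n => hs n t j) (ih j) (fun n => locm t ih n L le_rfl j)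
  have gV : ∀ t j, 0 ≤ V t j ∧ V t j ≤ G ^ 2 := by
    intro t
    induction t with
    | zero => intro j; rw [hV0]; simp [sq_nonneg]
    | succ t ih =>
      intro j
      rw [hVagg]
      exact fa_conv lam (fun n => s n t j) (fun n => v n L t j) _ _ _ hl0 hl1
        (fun n => hs n t j) (ih j) (fun n => locv t ih n L le_rfl j)
  have gMb : ∀ t j, -G ≤ Mb t j ∧ Mb t j ≤ G := by
    intro t j
    cases t with
    | zero => rw [hMb0]; simp [hG.le]
    | succ t =>
      rw [hMb]
      simpa using fa_conv lam (fun n => 1) (fun n => m n L t j) _ _ _ hl0 hl1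
        (fun n => Or.inr rfl) (gM t j) (fun n => locm t (gM t) n L le_rfl j)
  have gVb : ∀ t j, 0 ≤ Vb t j ∧ Vb t j ≤ G ^ 2 := by
    intro t j
    cases t with
    | zero => rw [hVb0]; simp [sq_nonneg]
    | succ t =>
      rw [hVb]
      simpa only [one_mul] using fa_conv lam (fun n => 1) (fun n => v n L t j) _ _ _ hl0 hl1
        (fun n => Or.inr rfl) (gV t j) (fun n => locv t (gV t) n L le_rfl j)
  have cm : ∀ l t j, -G ≤ mc l t j ∧ mc l t j ≤ G := by
    intro l t
    induction l with
    | zero => intro j; rw [hmc0]; exact gMb t j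
    | succ l ih =>
      intro j
      rw [hmcrec]
      exact fa_avg _ _ _ _ _ hβ₁0 hβ₁1 (ih j) (abs_le.1 (hbd3 _ _))
  have cv : ∀ l t j, 0 ≤ vc l t j ∧ vc l t j ≤ G ^ 2 := by
    intro l t
    induction l with
    | zero => intro j; rw [hvc0]; exact gVb t j
    | succ l ih =>
      intro j
      rw [hvcrec]
      exact fa_avg _ _ _ _ _ hβ₂0.le hβ₂1 (ih j) (sqb _ (hbd3 _ _))
  intro n t l hl
  have hb1 : 0 < 1 - β₁ := by linarith
  have hb2 : 0 < 1 - β₂ := by linarith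
  have hs2 : 0 ≤ 1 - √β₂ := by
    have : √β₂ ≤ 1 := Real.sqrt_le_iff.2 ⟨one_pos.le, by simpa using hβ₂1.le⟩
    linarith
  have hsb : 0 < √β₂ := Real.sqrt_pos.2 hβ₂0
  have hse : 0 < √ε := Real.sqrt_pos.2 hε
  have hφ0 : 0 ≤ φ := by rw [hφ]; positivity
  set g := gradFt n (l + 2) t (w n (l + 1) t) with hg
  set gc := gradF (wc (l + 1) t) with hgc
  have hgg : ‖g - gc‖ ≤ ρ * ‖w n (l + 1) t - wc (l + 1) t‖ + (σl / √(Dt n) + σg) := by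
    have h1 := hlip1 n (l + 2) t (w n (l + 1) t) (wc (l + 1) t)
    have h2 := hvar1 n (l + 2) t (wc (l + 1) t)
    have h3 := hvar2 n (wc (l + 1) t)
    have := norm_add₃_le (a := g - gradFt n (l + 2) t (wc (l + 1) t))
      (b := gradFt n (l + 2) t (wc (l + 1) t) - gradFn n (wc (l + 1) t))
      (c := gradFn n (wc (l + 1) t) - gc)
    rw [sub_add_sub_cancel, sub_add_sub_cancel] at this
    linarith
  set e : EuclideanSpace ℝ (Fin d) := (w n (l + 2) t - wc (l + 2) t)
    - (1 + φ) • (w n (l + 1) t - wc (l + 1) t) + φ • (w n l t - wc l t) with he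
  have hen := fa_norm d e (g - gc)
    (G * η * (2 * β₁ * (1 - √β₂) * (G ^ 2 + ε) / (ε * √(ε * β₂))
          + (1 - β₁) * β₂ * G ^ 2 / (ε * √ε)))
    ((1 - β₁) * η / √ε * (1 + (1 - β₂) * G ^ 2 / ε)) (by positivity) (by positivity) (by
      intro j
      have := fa_scalar β₁ β₂ η ε G (w n l t j) (w n (l + 1) t j) (m n (l + 1) t j)
        (v n (l + 1) t j) (g j) (w n (l + 2) t j) (wc l t j) (wc (l + 1) t j) (mc (l + 1) t j)
        (vc (l + 1) t j) (gc j) (wc (l + 2) t j) hβ₁0 hβ₁1 hβ₂0 hβ₂1 hη hε hG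
        (locv t (gV t) n _ (by omega) j) (cv _ _ _) (hbd1 _ _ _ _ _) (hbd3 _ _)
        (abs_le.2 (locm t (gM t) n _ (by omega) j)) (abs_le.2 (cm _ _ _))
        (hwrec n l t (by omega) j) (hwcrec l t j)
        (by rw [hwrec n (l + 1) t (by omega) j, hmrec n (l + 1) t (by omega) j,
              hvrec n (l + 1) t (by omega) j])
        (by rw [hwcrec (l + 1) t j, hmcrec (l + 1) t j, hvcrec (l + 1) t j])
      rw [← hφ] at this
      simpa [he] using this)
  have hw : w n (l + 2) t - wc (l + 2) t = (1 + φ) • (w n (l + 1) t - wc (l + 1) t)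
      - φ • (w n l t - wc l t) + e := by rw [he]; abel
  have hB : (1 - β₁) * η / √ε * (1 + (1 - β₂) * G ^ 2 / ε) ≤
      (1 - β₁) * η / √ε * (1 + (1 - β₂) * d * G ^ 2 / ε) := by
    have : (1 : ℝ) ≤ d := by exact_mod_cast hd
    gcongr
    nlinarith
  have hB2 := mul_le_mul hB hgg (norm_nonneg _) (by positivity)
  have hn1 : ‖w n (l + 2) t - wc (l + 2) t‖ ≤ (1 + φ) * ‖w n (l + 1) t - wc (l + 1) t‖
      + φ * ‖w n l t - wc l t‖ + ‖e‖ := by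
    conv_lhs => rw [hw]
    refine (norm_add_le _ _).trans ?_
    gcongr
    refine (norm_sub_le _ _).trans ?_
    rw [norm_smul, norm_smul, Real.norm_of_nonneg hφ0, Real.norm_of_nonneg (by linarith)]
  refine hn1.trans ?_
  have hfin := hen.trans (add_le_add_right hB2 _)
  rw [hψ, hχ, ← hφ]
  refine (add_le_add_right hfin _).trans (le_of_eq ?_)
  ring
end

section
/- (Proposition 1.) Let d ≥ 1, G > 0, ρ > 0, η > 0, ε > 0, β₁ ∈ [0,1), β₂ ∈ (0,1), and let l ≥ 1 be an integer. Define φ = β₁/√β₂, ψ = 1 + β₁/√β₂ + (ηρ(1−β₁)/√ε)(1 + (1−β₂)dG²/ε), r₊ = (ψ + √(ψ²+4φ))/2, r₋ = (ψ − √(ψ²+4φ))/2, Γ(l) = (1/√(ψ²+4φ)) [ r₋^l ( φ + (√(ψ²+4φ) − ψ)/2 − β₁(1−β₂)dG²ηρ/(ε√ε) ) + r₊^l ( (√(ψ²+4φ) + ψ)/2 − φ + β₁(1−β₂)dG²ηρ/(ε√ε) ) ], Λ(l) = (ηβ₁/(√ε·√(ψ²+4φ))) (r₊^l − r₋^l),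 and Θ(l) = (√d G η β₂/(2ε√ε·√(ψ²+4φ))) (r₊^l − r₋^l). If β₂ < 1 − 1/(1 + 2Gρ√d) and √d G β₂ > 2εβ₁, then Γ(l) > Θ(l) > Λ(l). -/
/-- **Proposition 1 (ordering of the deviation-bound coefficients).**
With the constants `φ, ψ, r₊, r₋, Γ(l), Λ(l), Θ(l)` of Theorem 1, if
`β₂ < 1 − 1/(1 + 2Gρ√d)` and `√d G β₂ > 2εβ₁`, then `Γ(l) > Θ(l) > Λ(l)`. -/
theorem coefficient_ordering (d : ℕ) (hd : 1 ≤ d)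
    (G ρ η ε β₁ β₂ : ℝ)
    (hG : 0 < G) (hρ : 0 < ρ) (hη : 0 < η) (hε : 0 < ε)
    (hβ₁0 : 0 ≤ β₁) (hβ₁1 : β₁ < 1) (hβ₂0 : 0 < β₂) (hβ₂1 : β₂ < 1)
    (l : ℕ) (hl : 1 ≤ l)
    (φ ψ rp rm : ℝ) (Γ Λ Θ : ℕ → ℝ)
    (hφ : φ = β₁ / Real.sqrt β₂)
    (hψ : ψ = 1 + β₁ / Real.sqrt β₂
      + η * ρ * (1 - β₁) / Real.sqrt ε * (1 + (1 - β₂) * d * G ^ 2 / ε))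
    (hrp : rp = (ψ + Real.sqrt (ψ ^ 2 + 4 * φ)) / 2)
    (hrm : rm = (ψ - Real.sqrt (ψ ^ 2 + 4 * φ)) / 2)
    (hΓ : ∀ l, Γ l = (1 / Real.sqrt (ψ ^ 2 + 4 * φ)) *
      (rm ^ l * (φ + (Real.sqrt (ψ ^ 2 + 4 * φ) - ψ) / 2
          - β₁ * (1 - β₂) * d * G ^ 2 * η * ρ / (ε * Real.sqrt ε))
        + rp ^ l * ((Real.sqrt (ψ ^ 2 + 4 * φ) + ψ) / 2 - φ
          + β₁ * (1 - β₂) * d * G ^ 2 * η * ρ / (ε * Real.sqrt ε))))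
    (hΛ : ∀ l, Λ l = η * β₁ / (Real.sqrt ε * Real.sqrt (ψ ^ 2 + 4 * φ)) *
      (rp ^ l - rm ^ l))
    (hΘ : ∀ l, Θ l = Real.sqrt d * G * η * β₂ /
      (2 * ε * Real.sqrt ε * Real.sqrt (ψ ^ 2 + 4 * φ)) * (rp ^ l - rm ^ l))
    (hcond : β₂ < 1 - 1 / (1 + 2 * G * ρ * Real.sqrt d))
    (hsmall : 2 * ε * β₁ < Real.sqrt d * G * β₂) :
    Θ l < Γ l ∧ Λ l < Θ l := by
  set s := Real.sqrt ε with hs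
  set D := Real.sqrt (d : ℝ) with hD
  have hs0 : 0 < s := Real.sqrt_pos.mpr hε
  have hd0 : (0 : ℝ) < d := by exact_mod_cast hd
  have hD0 : 0 < D := Real.sqrt_pos.mpr hd0
  have hDD : (d : ℝ) = D ^ 2 := (Real.sq_sqrt hd0.le).symm
  have hφ0 : 0 ≤ φ := by rw [hφ]; positivity
  rw [← hφ] at hψ
  have h1 : 0 < 1 - β₁ := by linarith
  have h2 : 0 < 1 - β₂ := by linarith
  have hA : 0 < η * ρ * (1 - β₁) / s := by positivity
  have hψ0 : 0 < ψ := by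
    rw [hψ]; positivity
  set S := Real.sqrt (ψ ^ 2 + 4 * φ) with hS
  have hS0 : 0 < S := Real.sqrt_pos.mpr (by positivity)
  have hSS : S ^ 2 = ψ ^ 2 + 4 * φ := Real.sq_sqrt (by positivity)
  have hsum : rp + rm = ψ := by rw [hrp, hrm]; ring
  have hprod : rp * rm = -φ := by
    rw [hrp, hrm]; linear_combination (-1 / 4) * hSS
  have hrp0 : 0 < rp := by rw [hrp]; positivity
  have hdiff : rp - rm = S := by rw [hrp, hrm]; ring
  have habs : |rm| < rp := abs_lt.mpr ⟨by linarith, by linarith⟩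
  have hpos : ∀ n : ℕ, n ≠ 0 → 0 < rp ^ n - rm ^ n := by
    intro n hn
    have h3 : |rm| ^ n < rp ^ n := pow_lt_pow_left₀ habs (abs_nonneg _) hn
    have h4 : rm ^ n ≤ |rm| ^ n := by rw [← abs_pow]; exact le_abs_self _
    linarith
  have hUl : 0 < rp ^ l - rm ^ l := hpos l (by omega)
  have hrec : ψ * (rp ^ l - rm ^ l) ≤ rp ^ (l + 1) - rm ^ (l + 1) := by
    obtain ⟨k, rfl⟩ : ∃ k, l = k + 1 := ⟨l - 1, by omega⟩
    have hk : 0 ≤ rp ^ k - rm ^ k := by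
      rcases Nat.eq_zero_or_pos k with rfl | hk
      · simp
      · exact (hpos k (by omega)).le
    have : rp ^ (k + 1 + 1) - rm ^ (k + 1 + 1)
        = ψ * (rp ^ (k + 1) - rm ^ (k + 1)) + φ * (rp ^ k - rm ^ k) := by
      have hφ' : φ = -(rp * rm) := by linarith
      rw [hφ', ← hsum]; ring
    rw [this]
    have := mul_nonneg hφ0 hk
    linarith
  have hc : β₂ < (1 - β₂) * (2 * G * ρ * D) := by
    have hP : 0 < 1 + 2 * G * ρ * D := by positivity
    have h5 : 1 / (1 + 2 * G * ρ * D) < 1 - β₂ := by linarith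
    rw [div_lt_iff₀ hP] at h5
    linarith
  have hkey : D * G * η * β₂ / (2 * ε * s) < η * ρ * (1 - β₂) * d * G ^ 2 / (ε * s) := by
    have h6 : D * G * η * β₂ < D * G * η * ((1 - β₂) * (2 * G * ρ * D)) :=
      mul_lt_mul_of_pos_left hc (by positivity)
    have h7 : η * ρ * (1 - β₂) * d * G ^ 2 / (ε * s)
        = D * G * η * ((1 - β₂) * (2 * G * ρ * D)) / (2 * ε * s) := by
      rw [hDD]; field_simp
    rw [h7]
    exact div_lt_div_of_pos_right h6 (by positivity)
  have hcoef : φ - β₁ * (1 - β₂) * d * G ^ 2 * η * ρ / (ε * s) + D * G * η * β₂ / (2 * ε * s)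
      < ψ := by
    have h8 : ψ = 1 + φ + η * ρ * (1 - β₁) / s + η * ρ * (1 - β₂) * d * G ^ 2 / (ε * s)
        - β₁ * (1 - β₂) * d * G ^ 2 * η * ρ / (ε * s) := by
      rw [hψ]; field_simp; ring
    linarith
  constructor
  · have e1 : Γ l = (1 / S) * ((rp ^ (l + 1) - rm ^ (l + 1))
        - (φ - β₁ * (1 - β₂) * d * G ^ 2 * η * ρ / (ε * s)) * (rp ^ l - rm ^ l)) := by
      have a1 : (S - ψ) / 2 = -rm := by rw [hrm]; ring
      have a2 : (S + ψ) / 2 = rp := by rw [hrp]; ring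
      rw [hΓ, a1, a2]; ring
    have e2 : Θ l = (1 / S) * (D * G * η * β₂ / (2 * ε * s) * (rp ^ l - rm ^ l)) := by
      rw [hΘ]; field_simp
    rw [e1, e2]
    apply mul_lt_mul_of_pos_left _ (by positivity)
    have := mul_lt_mul_of_pos_right hcoef hUl
    linarith
  · rw [hΛ, hΘ]
    apply mul_lt_mul_of_pos_right _ hUl
    have e3 : η * β₁ / (s * S) = η * (2 * ε * β₁) / (2 * ε * s * S) := by field_simp
    rw [e3]
    apply div_lt_div_of_pos_right _ (by positivity)
    have := mul_lt_mul_of_pos_left hsmall hη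
    linarith
end
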